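/- The asymptotic behavior α_{i,j} ~ ((j+1)^{2j+1}/j!)·(j+1)^i holds as i → ∞ with j fixed, where α_{i,j} are defined by α_{i,0}=α_{0,i}=1 and α_{i+1,j+1} = α_{i+1,j}+α_{i,j+1}+(1/2)∑_{p=0}^i∑_{q=0}^j binomial(i+j+4,p+q+2)α_{p,q}α_{i-p,j-q}. -/

import Mathlib

open Finset in
theorem alternating_sum_choose_mul_succ_pow (l : ℕ) :
    ∑ k ∈ range (l + 2), (-1 : ℝ) ^ (l + 1 - k) * ((l + 1).choose k : ℝ) * ((k : ℝ) + 1) ^ l = 0 := by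
  have h := fwdDiff_iter_eq_sum_shift (1 : ℝ) (fun r : ℝ => r ^ l) (l + 1) 1
  rw [fwdDiff_iter_pow_eq_zero_of_lt (Nat.lt_succ_self l)] at h
  rw [Pi.zero_apply] at h
  rw [h]
  refine sum_congr rfl fun k _ => ?_
  rw [zsmul_eq_mul, nsmul_eq_mul]
  push_cast
  ring

/-- A case of Abel's binomial theorem. -/
theorem abel_sum_eq_pow (n : ℕ) (Y : ℝ) :
    ∑ k ∈ Finset.range (n + 1), (n.choose k : ℝ) * ((k : ℝ) + 1) ^ (k - 1)
      * (Y - ((k : ℝ) + 1)) ^ (n - k) = Y ^ n := by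
  have hexp : ∀ k ∈ Finset.range (n + 1), (n.choose k : ℝ) * ((k : ℝ) + 1) ^ (k - 1)
      * (Y - ((k : ℝ) + 1)) ^ (n - k) = ∑ m ∈ Finset.range (n + 1 - k),
        (n.choose k : ℝ) * ((k : ℝ) + 1) ^ (k - 1)
          * ((-((k : ℝ) + 1)) ^ m * Y ^ (n - k - m) * ((n - k).choose m : ℝ)) := by
    intro k hk
    have hk' : n + 1 - k = n - k + 1 := by
      have := Finset.mem_range.1 hk
      omega
    rw [← Finset.mul_sum, hk', ← add_pow, neg_add_eq_sub]
  rw [Finset.sum_congr rfl hexp, ← Finset.sum_range_diag_flip (n + 1) (fun k m =>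
    (n.choose k : ℝ) * ((k : ℝ) + 1) ^ (k - 1)
          * ((-((k : ℝ) + 1)) ^ m * Y ^ (n - k - m) * ((n - k).choose m : ℝ))),
    Finset.sum_range_succ']
  have hzero : ∀ l ∈ Finset.range n, ∑ k ∈ Finset.range (l + 1 + 1),
      (n.choose k : ℝ) * ((k : ℝ) + 1) ^ (k - 1) * ((-((k : ℝ) + 1)) ^ (l + 1 - k)
        * Y ^ (n - k - (l + 1 - k)) * ((n - k).choose (l + 1 - k) : ℝ)) = 0 := by
    intro l _
    rw [← mul_zero ((n.choose (l + 1) : ℝ) * Y ^ (n - (l + 1))),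
      ← alternating_sum_choose_mul_succ_pow l, Finset.mul_sum]
    refine Finset.sum_congr rfl fun k hk => ?_
    have hkl : k ≤ l + 1 := Nat.lt_succ_iff.1 (Finset.mem_range.1 hk)
    have hc : (n.choose (l + 1) : ℝ) * ((l + 1).choose k : ℝ)
        = (n.choose k : ℝ) * ((n - k).choose (l + 1 - k) : ℝ) := by
      exact_mod_cast Nat.choose_mul hkl
    have hp : ((k : ℝ) + 1) ^ l = ((k : ℝ) + 1) ^ (k - 1) * ((k : ℝ) + 1) ^ (l + 1 - k) := by
      rcases Nat.eq_zero_or_pos k with rfl | hk0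
      · simp
      · rw [← pow_add]
        congr 1
        omega
    have he : n - k - (l + 1 - k) = n - (l + 1) := by omega
    rw [he, neg_pow ((k : ℝ) + 1), hp]
    linear_combination (-((k : ℝ) + 1) ^ (k - 1) * ((k : ℝ) + 1) ^ (l + 1 - k)
      * Y ^ (n - (l + 1)) * (-1) ^ (l + 1 - k)) * hc
  rw [Finset.sum_eq_zero hzero]
  simp

theorem sum_choose_mul_tree_pow (n : ℕ) :
    ((n : ℝ) + 2) * ∑ k ∈ Finset.range (n + 1), (n.choose k : ℝ) * ((k : ℝ) + 1) ^ (k - 1)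
      * (((n - k : ℕ) : ℝ) + 1) ^ (n - k - 1) = 2 * ((n : ℝ) + 2) ^ n := by
  set f : ℕ → ℝ := fun k => (n.choose k : ℝ) * ((k : ℝ) + 1) ^ (k - 1)
      * (((n - k : ℕ) : ℝ) + 1) ^ (n - k) with hf
  have hpow : ∀ k : ℕ, ((k : ℝ) + 1) ^ k = ((k : ℝ) + 1) * ((k : ℝ) + 1) ^ (k - 1) := by
    intro k
    cases k with
    | zero => simp
    | succ k => rw [Nat.add_sub_cancel, pow_succ']
  have hsum : ∑ k ∈ Finset.range (n + 1), f k = ((n : ℝ) + 2) ^ n := by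
    rw [← abel_sum_eq_pow n ((n : ℝ) + 2)]
    refine Finset.sum_congr rfl fun k hk => ?_
    have hkn : k ≤ n := Nat.lt_succ_iff.1 (Finset.mem_range.1 hk)
    simp only [hf]
    rw [Nat.cast_sub hkn]
    ring_nf
  have hflip : ∑ k ∈ Finset.range (n + 1), f (n - k) = ((n : ℝ) + 2) ^ n := by
    rw [Finset.sum_flip, hsum]
  rw [two_mul]
  nth_rewrite 1 [← hsum]
  rw [← hflip, Finset.mul_sum, ← Finset.sum_add_distrib]
  refine Finset.sum_congr rfl fun k hk => ?_
  have hkn : k ≤ n := Nat.lt_succ_iff.1 (Finset.mem_range.1 hk)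
  have hn : (n : ℝ) + 2 = ((k : ℝ) + 1) + (((n - k : ℕ) : ℝ) + 1) := by
    rw [Nat.cast_sub hkn]
    ring
  simp only [hf]
  rw [Nat.sub_sub_self hkn, Nat.choose_symm hkn, hpow k, hpow (n - k), hn]
  ring

open Filter Topology in
theorem tendsto_binomial_weight_zero {x y : ℝ} (hx : 0 < x) (hy : 0 < y) (k : ℕ) :
    Tendsto (fun N : ℕ => (N.choose k : ℝ) * x ^ k * y ^ (N - k) / (x + y) ^ N) atTop (𝓝 0) := by
  have hxy : 0 < x + y := by positivity
  have hr : |y / (x + y)| < 1 := by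
    rw [abs_of_pos (by positivity), div_lt_one hxy]
    linarith
  have h := (tendsto_pow_const_mul_const_pow_of_abs_lt_one k hr).const_mul ((x / y) ^ k)
  rw [mul_zero] at h
  refine squeeze_zero' (Eventually.of_forall fun N => by positivity) ?_ h
  filter_upwards [eventually_ge_atTop k] with N hN
  have hc : (N.choose k : ℝ) ≤ (N : ℝ) ^ k := by exact_mod_cast Nat.choose_le_pow N k
  have hyN : y ^ N = y ^ (N - k) * y ^ k := by rw [← pow_add, Nat.sub_add_cancel hN]
  calc (N.choose k : ℝ) * x ^ k * y ^ (N - k) / (x + y) ^ N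
      ≤ (N : ℝ) ^ k * x ^ k * y ^ (N - k) / (x + y) ^ N := by gcongr
    _ = (x / y) ^ k * ((N : ℝ) ^ k * (y / (x + y)) ^ N) := by
      rw [div_pow, div_pow, hyN]
      field_simp

theorem sum_binomial_weight {x y : ℝ} (hx : 0 < x) (hy : 0 < y) (N : ℕ) :
    ∑ k ∈ Finset.range (N + 1), (N.choose k : ℝ) * x ^ k * y ^ (N - k) / (x + y) ^ N = 1 := by
  have hxy : x + y ≠ 0 := by positivity
  rw [← Finset.sum_div, div_eq_one_iff_eq (pow_ne_zero _ hxy), add_pow]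
  exact Finset.sum_congr rfl fun k _ => by ring

open Filter Topology in
theorem tendsto_binomial_average_zero {x y : ℝ} (hx : 0 < x) (hy : 0 < y) {e : ℕ → ℝ}
    (he : Tendsto e atTop (𝓝 0)) :
    Tendsto (fun N : ℕ => ∑ k ∈ Finset.range (N + 1),
      (N.choose k : ℝ) * x ^ k * y ^ (N - k) / (x + y) ^ N * |e k|) atTop (𝓝 0) := by
  rw [Metric.tendsto_atTop] at he
  rw [tendsto_order]
  refine ⟨fun b hb => Eventually.of_forall fun N => hb.trans_le
    (Finset.sum_nonneg fun k _ => by positivity), fun ε hε => ?_⟩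
  obtain ⟨K, hK⟩ := he (ε / 2) (by positivity)
  have hfin : Tendsto (fun N : ℕ => ∑ k ∈ Finset.range K,
      (N.choose k : ℝ) * x ^ k * y ^ (N - k) / (x + y) ^ N * |e k|) atTop (𝓝 0) := by
    have := tendsto_finsetSum (Finset.range K) fun k _ =>
      (tendsto_binomial_weight_zero hx hy k).mul_const |e k|
    simpa using this
  filter_upwards [hfin.eventually_lt_const (half_pos hε)] with N hN
  have hterm : ∀ k ∈ Finset.range (N + 1),
      (N.choose k : ℝ) * x ^ k * y ^ (N - k) / (x + y) ^ N * |e k|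
      ≤ (if k ∈ Finset.range K then
          (N.choose k : ℝ) * x ^ k * y ^ (N - k) / (x + y) ^ N * |e k| else 0)
        + (N.choose k : ℝ) * x ^ k * y ^ (N - k) / (x + y) ^ N * (ε / 2) := by
    intro k _
    split_ifs with h
    · exact le_add_of_nonneg_right (by positivity)
    · rw [zero_add]
      have := hK k (by simpa using h)
      rw [Real.dist_eq, sub_zero] at this
      gcongr
  calc _ ≤ _ := Finset.sum_le_sum hterm
    _ < ε / 2 + ε / 2 := by
      rw [Finset.sum_add_distrib, ← Finset.sum_mul, sum_binomial_weight hx hy, one_mul]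
      refine add_lt_add_left (lt_of_le_of_lt ?_ hN) _
      rw [← Finset.sum_filter]
      refine Finset.sum_le_sum_of_subset_of_nonneg (fun k hk => (Finset.mem_filter.1 hk).2)
        fun k _ _ => by positivity
    _ = ε := add_halves ε

open Filter Topology in
theorem tendsto_binomial_convolution {x y : ℝ} (hx : 0 < x) (hy : 0 < y) {U V : ℕ → ℝ} {C D : ℝ}
    (hU : Tendsto U atTop (𝓝 C)) (hV : Tendsto V atTop (𝓝 D)) :
    Tendsto (fun N : ℕ => ∑ k ∈ Finset.range (N + 1),
      (N.choose k : ℝ) * x ^ k * y ^ (N - k) / (x + y) ^ N * (U k * V (N - k)))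
      atTop (𝓝 (C * D)) := by
  obtain ⟨M, hM⟩ := hV.abs.bddAbove_range
  have hM' : ∀ n, |V n| ≤ M := fun n => hM ⟨n, rfl⟩
  have hA := tendsto_binomial_average_zero hx hy (tendsto_sub_nhds_zero_iff.2 hU)
  have hB := tendsto_binomial_average_zero hy hx (tendsto_sub_nhds_zero_iff.2 hV)
  have hAB := (hA.const_mul M).add (hB.const_mul |C|)
  rw [mul_zero, mul_zero, add_zero] at hAB
  rw [← tendsto_sub_nhds_zero_iff]
  refine squeeze_zero_norm (fun N => ?_) hAB
  have hBN : ∑ k ∈ Finset.range (N + 1),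
      (N.choose k : ℝ) * y ^ k * x ^ (N - k) / (y + x) ^ N * |V k - D|
      = ∑ k ∈ Finset.range (N + 1),
      (N.choose k : ℝ) * x ^ k * y ^ (N - k) / (x + y) ^ N * |V (N - k) - D| := by
    rw [← Finset.sum_flip]
    refine Finset.sum_congr rfl fun k hk => ?_
    have hkn : k ≤ N := Nat.lt_succ_iff.1 (Finset.mem_range.1 hk)
    rw [Nat.sub_sub_self hkn, Nat.choose_symm hkn, add_comm y x]
    ring
  have hCD : C * D = ∑ k ∈ Finset.range (N + 1),
      (N.choose k : ℝ) * x ^ k * y ^ (N - k) / (x + y) ^ N * (C * D) := by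
    rw [← Finset.sum_mul, sum_binomial_weight hx hy, one_mul]
  rw [hBN]
  nth_rewrite 1 [hCD]
  rw [← Finset.sum_sub_distrib, Finset.mul_sum, Finset.mul_sum, ← Finset.sum_add_distrib]
  refine (norm_sum_le _ _).trans (Finset.sum_le_sum fun k _ => ?_)
  rw [← mul_sub, norm_mul, Real.norm_of_nonneg (by positivity), Real.norm_eq_abs]
  have hkey : |U k * V (N - k) - C * D| ≤ M * |U k - C| + |C| * |V (N - k) - D| := by
    have h0 : U k * V (N - k) - C * D = V (N - k) * (U k - C) + C * (V (N - k) - D) := by ring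
    rw [h0]
    refine (abs_add_le _ _).trans ?_
    rw [abs_mul, abs_mul]
    gcongr
    exact hM' _
  refine (mul_le_mul_of_nonneg_left hkey (by positivity)).trans_eq ?_
  ring

open Filter Topology in
theorem tendsto_shifted_binomial_convolution {x y : ℝ} (hx : 0 < x) (hy : 0 < y) {u v : ℕ → ℝ}
    {c d : ℝ} (hu : Tendsto (fun i => u i / x ^ i) atTop (𝓝 c))
    (hv : Tendsto (fun i => v i / y ^ i) atTop (𝓝 d)) (s t : ℕ) :
    Tendsto (fun i : ℕ => (∑ p ∈ Finset.range (i + 1),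
      ((i + (s + t)).choose (p + s) : ℝ) * u p * v (i - p)) / (x + y) ^ (i + (s + t)))
      atTop (𝓝 (c / x ^ s * (d / y ^ t))) := by
  have shift : ∀ {z : ℝ} (_ : 0 < z) {w : ℕ → ℝ} {e : ℝ} (r : ℕ)
      (_ : Tendsto (fun i => w i / z ^ i) atTop (𝓝 e)),
      Tendsto (fun k => if k < r then 0 else w (k - r) / z ^ k) atTop (𝓝 (e / z ^ r)) := by
    intro z hz w e r hw
    refine (tendsto_add_atTop_iff_nat r).1 ?_
    refine (hw.div_const (z ^ r)).congr fun k => ?_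
    rw [if_neg (by omega), Nat.add_sub_cancel, pow_add, div_div]
  have h := (tendsto_binomial_convolution hx hy (shift hx s hu) (shift hy t hv)).comp
    (tendsto_add_atTop_nat (s + t))
  refine h.congr fun i => ?_
  simp only [Function.comp]
  rw [show i + (s + t) + 1 = s + ((i + 1) + t) by ring, Finset.sum_range_add,
    Finset.sum_range_add, Finset.sum_div]
  rw [Finset.sum_eq_zero, zero_add, add_eq_left.2]
  · refine Finset.sum_congr rfl fun p hp => ?_
    have hpi : p ≤ i := Nat.lt_succ_iff.1 (Finset.mem_range.1 hp)
    rw [if_neg (by omega), if_neg (by omega), Nat.add_sub_cancel_left,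
      show i + (s + t) - (s + p) - t = i - p by omega, add_comm s p]
    field_simp
  · refine Finset.sum_eq_zero fun k hk => ?_
    have := Finset.mem_range.1 hk
    rw [if_pos (c := i + (s + t) - (s + (i + 1 + k)) < t) (by omega)]
    simp
  · intro k hk
    rw [if_pos (Finset.mem_range.1 hk)]
    simp

open Filter Topology Asymptotics in
theorem tendsto_div_pow_of_tendsto_succ_sub_div_pow {m G : ℝ} (hm : 1 < m) {f : ℕ → ℝ}
    (hf : Tendsto (fun i => (f (i + 1) - f i) / m ^ i) atTop (𝓝 G)) :
    Tendsto (fun i => f i / m ^ i) atTop (𝓝 (G / (m - 1))) := by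
  have hm0 : 0 < m := by linarith
  have hm1 : m - 1 ≠ 0 := by linarith
  have hpow : ∀ i, m ^ i ≠ 0 := fun i => (pow_pos hm0 i).ne'
  have hinv : Tendsto (fun i => (m ^ i)⁻¹) atTop (𝓝 0) :=
    (tendsto_pow_atTop_atTop_of_one_lt hm).inv_tendsto_atTop
  have hlo : (fun i => (f (i + 1) - f i) - G * m ^ i) =o[atTop] fun i => m ^ i := by
    rw [isLittleO_iff_tendsto fun i hi => absurd hi (hpow i)]
    refine (tendsto_sub_nhds_zero_iff.2 hf).congr fun i => ?_
    have := hpow i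
    field_simp
  have hgeom : ∀ n, ∑ i ∈ Finset.range n, m ^ i = (m ^ n - 1) / (m - 1) :=
    fun n => geom_sum_eq hm.ne' n
  have hdiv : Tendsto (fun n => ∑ i ∈ Finset.range n, m ^ i) atTop atTop := by
    simp only [hgeom]
    exact (tendsto_atTop_add_const_right _ (-1)
      (tendsto_pow_atTop_atTop_of_one_lt hm)).atTop_div_const (by linarith)
  have hsum := hlo.sum_range (fun i => (pow_pos hm0 i).le) hdiv
  have hO : (fun n => ∑ i ∈ Finset.range n, m ^ i) =O[atTop] fun n => m ^ n := by
    refine IsBigO.of_bound (1 / (m - 1)) (Eventually.of_forall fun n => ?_)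
    have h1 : (1 : ℝ) ≤ m ^ n := one_le_pow₀ hm.le
    have h2 : 0 < m - 1 := by linarith
    rw [hgeom, Real.norm_of_nonneg (div_nonneg (by linarith) h2.le),
      Real.norm_of_nonneg (by positivity), div_mul_eq_mul_div, one_mul]
    gcongr
    linarith
  have hz := (hsum.trans_isBigO hO).tendsto_div_nhds_zero
  have hlim := (hz.add_const (G / (m - 1))).add (hinv.const_mul (f 0 - G / (m - 1)))
  rw [zero_add, mul_zero, add_zero] at hlim
  refine hlim.congr fun n => ?_
  rw [Finset.sum_sub_distrib, Finset.sum_range_sub, ← Finset.mul_sum, hgeom]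
  have := hpow n
  field_simp
  ring

open Filter Topology in
theorem tendsto_div_pow_of_betti_recurrence (b : ℕ → ℕ → ℝ) (h1 : ∀ i, b i 0 = 1)
    (hrec : ∀ i j, b (i + 1) (j + 1) = b (i + 1) j + b i (j + 1)
      + (1 / 2) * ∑ p ∈ Finset.range (i + 1), ∑ q ∈ Finset.range (j + 1),
          ((i + j + 4).choose (p + q + 2) : ℝ) * b p q * b (i - p) (j - q)) (j : ℕ) :
    Tendsto (fun i : ℕ => b i j / ((j : ℝ) + 1) ^ i) atTop
      (𝓝 (((j : ℝ) + 1) ^ (2 * j + 1) / (j.factorial : ℝ))) := by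
  induction j using Nat.strong_induction_on with
  | _ j ih =>
  rcases j with _ | j
  · simp [h1]
  have hj : (0 : ℝ) < (j : ℝ) + 1 := by positivity
  have hm : (1 : ℝ) < (j : ℝ) + 2 := by linarith
  have hlow : Tendsto (fun i => b (i + 1) j / ((j : ℝ) + 2) ^ i) atTop (𝓝 0) := by
    have hr : ((j : ℝ) + 1) / ((j : ℝ) + 2) < 1 := by
      rw [div_lt_one (by positivity)]
      linarith
    have h := (((ih j j.lt_succ_self).comp (tendsto_add_atTop_nat 1)).mul
      (tendsto_pow_atTop_nhds_zero_of_lt_one (by positivity) hr)).mul_const ((j : ℝ) + 1)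
    rw [mul_zero, zero_mul] at h
    refine h.congr fun i => ?_
    simp only [Function.comp]
    rw [div_pow, pow_succ]
    field_simp
  have hconv : ∀ q ∈ Finset.range (j + 1), Tendsto (fun i : ℕ =>
      (∑ p ∈ Finset.range (i + 1), ((i + j + 4).choose (p + q + 2) : ℝ) * b p q
        * b (i - p) (j - q)) / ((j : ℝ) + 2) ^ (i + j + 4)) atTop
      (𝓝 (((q : ℝ) + 1) ^ (q - 1) / (q.factorial : ℝ)
        * ((((j - q : ℕ) : ℝ) + 1) ^ (j - q - 1) / ((j - q).factorial : ℝ)))) := by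
    intro q hq
    have hqj : q ≤ j := Nat.lt_succ_iff.1 (Finset.mem_range.1 hq)
    have hcoef : ∀ r : ℕ, ((r : ℝ) + 1) ^ (2 * r + 1) / (r.factorial : ℝ) / ((r : ℝ) + 1) ^ (r + 2)
        = ((r : ℝ) + 1) ^ (r - 1) / (r.factorial : ℝ) := by
      intro r
      rcases r with _ | r
      · simp
      · rw [show 2 * (r + 1) + 1 = (r + 1 - 1) + (r + 1 + 2) by omega, pow_add]
        field_simp
    have h := tendsto_shifted_binomial_convolution (by positivity) (by positivity)
      (ih q (by omega)) (ih (j - q) (by omega)) (q + 2) (j - q + 2)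
    rw [hcoef, hcoef] at h
    refine h.congr fun i => ?_
    have hxy : (q : ℝ) + 1 + (((j - q : ℕ) : ℝ) + 1) = (j : ℝ) + 2 := by
      rw [Nat.cast_sub hqj]
      ring
    rw [hxy, show i + (q + 2 + (j - q + 2)) = i + j + 4 by omega]
    rfl
  have htree : ∑ q ∈ Finset.range (j + 1), (((q : ℝ) + 1) ^ (q - 1) / (q.factorial : ℝ)
        * ((((j - q : ℕ) : ℝ) + 1) ^ (j - q - 1) / ((j - q).factorial : ℝ)))
      = 2 * ((j : ℝ) + 2) ^ j / (((j : ℝ) + 2) * (j.factorial : ℝ)) := by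
    rw [← sum_choose_mul_tree_pow j, mul_div_mul_left _ _ (by positivity), Finset.sum_div]
    refine Finset.sum_congr rfl fun q hq => ?_
    have hqj : q ≤ j := Nat.lt_succ_iff.1 (Finset.mem_range.1 hq)
    have hfac : (j.choose q : ℝ) * (q.factorial : ℝ) * ((j - q).factorial : ℝ)
        = (j.factorial : ℝ) := by exact_mod_cast Nat.choose_mul_factorial_mul_factorial hqj
    rw [← hfac]
    have : (j.choose q : ℝ) ≠ 0 := by exact_mod_cast (Nat.choose_pos hqj).ne'
    field_simp
  have hsum := tendsto_finsetSum _ hconv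
  rw [htree] at hsum
  have hdiff : Tendsto (fun i => (b (i + 1) (j + 1) - b i (j + 1)) / ((j : ℝ) + 2) ^ i) atTop
      (𝓝 (((j : ℝ) + 2) ^ (2 * j + 3) / (j.factorial : ℝ))) := by
    have h := hlow.add (hsum.const_mul (1 / 2 * ((j : ℝ) + 2) ^ (j + 4)))
    have hval : 0 + 1 / 2 * ((j : ℝ) + 2) ^ (j + 4)
        * (2 * ((j : ℝ) + 2) ^ j / (((j : ℝ) + 2) * (j.factorial : ℝ)))
        = ((j : ℝ) + 2) ^ (2 * j + 3) / (j.factorial : ℝ) := by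
      field_simp
      ring
    rw [hval] at h
    refine h.congr fun i => ?_
    rw [hrec, Finset.sum_comm, ← Finset.sum_div, add_assoc i j 4, pow_add _ i (j + 4)]
    field_simp
    ring
  have h := tendsto_div_pow_of_tendsto_succ_sub_div_pow hm
    (f := fun i => b i (j + 1)) hdiff
  have hval : ((j : ℝ) + 2) ^ (2 * j + 3) / (j.factorial : ℝ) / ((j : ℝ) + 2 - 1)
      = (((j + 1 : ℕ) : ℝ) + 1) ^ (2 * (j + 1) + 1) / ((j + 1).factorial : ℝ) := by
    rw [Nat.factorial_succ, show (j : ℝ) + 2 - 1 = (j : ℝ) + 1 by ring]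
    push_cast
    rw [show (j : ℝ) + 1 + 1 = (j : ℝ) + 2 by ring, div_div, mul_comm ((j : ℝ) + 1)]
    rfl
  rw [hval] at h
  refine h.congr fun i => ?_
  push_cast
  rw [show (j : ℝ) + 1 + 1 = (j : ℝ) + 2 by ring]


open Filter in
theorem alpha_asymptotics (a : ℕ → ℕ → ℚ)
    (h1 : ∀ i, a i 0 = 1) (h2 : ∀ i, a 0 i = 1)
    (hrec : ∀ i j, a (i + 1) (j + 1) = a (i + 1) j + a i (j + 1)
      + (1 / 2) * ∑ p ∈ Finset.range (i + 1), ∑ q ∈ Finset.range (j + 1),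
          ((i + j + 4).choose (p + q + 2) : ℚ) * a p q * a (i - p) (j - q))
    (j : ℕ) :
    Tendsto (fun i : ℕ => (a i j : ℝ) /
        ((((j : ℝ) + 1) ^ (2 * j + 1) / (j.factorial : ℝ)) * ((j : ℝ) + 1) ^ i))
      atTop (nhds 1) := by
  have h := tendsto_div_pow_of_betti_recurrence (fun i j => (a i j : ℝ))
    (fun i => by simp [h1]) (fun i j => by simp [hrec]) j
  have hpos : (0 : ℝ) < ((j : ℝ) + 1) ^ (2 * j + 1) / (j.factorial : ℝ) := by positivity
  have hdiv := h.div_const (((j : ℝ) + 1) ^ (2 * j + 1) / (j.factorial : ℝ))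
  rw [div_self hpos.ne'] at hdiv
  refine hdiv.congr fun i => ?_
  rw [div_div, mul_comm]
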